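/- Let ξ, μ, ν be finite measures on ℝ with finite first moments such that ξ ≤ μ (setwise) and μ ≤_E ν. Then ξ ≤_E ν, ξ ≤_E S^ν(μ), and S^{S^ν(μ)}(ξ) = S^ν(ξ). -/

import Mathlib

open MeasureTheory Set Filter

noncomputable def pot (eta : Measure ℝ) (k : ℝ) : ℝ := ∫ x, max (k - x) 0 ∂eta

noncomputable def cpot (eta : Measure ℝ) (k : ℝ) : ℝ := ∫ x, max (x - k) 0 ∂eta

/-- `c` is the convex hull (largest convex minorant) of `f`. -/
def IsConvexHull (f c : ℝ → ℝ) : Prop :=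
  ConvexOn ℝ Set.univ c ∧ (∀ x, c x ≤ f x) ∧
    ∀ g : ℝ → ℝ, ConvexOn ℝ Set.univ g → (∀ x, g x ≤ f x) → ∀ x, g x ≤ c x

/-- Convex order: `∫ f dη ≤ ∫ f dχ` for all convex `f` for which both integrals exist. -/
def Cx (eta chi : Measure ℝ) : Prop :=
  ∀ f : ℝ → ℝ, ConvexOn ℝ Set.univ f → Integrable f eta → Integrable f chi →
    ∫ x, f x ∂eta ≤ ∫ x, f x ∂chi

/-- Extended convex order: `∫ f dη ≤ ∫ f dχ` for all nonnegative convex `f`. -/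
def ECx (eta chi : Measure ℝ) : Prop :=
  ∀ f : ℝ → ℝ, ConvexOn ℝ Set.univ f → (∀ x, 0 ≤ f x) →
    ∫⁻ x, ENNReal.ofReal (f x) ∂eta ≤ ∫⁻ x, ENNReal.ofReal (f x) ∂chi

/-- The class `𝒟(a, b)`: nonnegative, nondecreasing, convex functions vanishing at `-∞`
and asymptotic to `a * z - b` at `+∞`. -/
def MemD (a b : ℝ) (f : ℝ → ℝ) : Prop :=
  ConvexOn ℝ Set.univ f ∧ Monotone f ∧ (∀ x, 0 ≤ f x) ∧
    Tendsto f atBot (nhds 0) ∧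
    Tendsto (fun z => f z - (a * z - b)) atTop (nhds 0)

/-- `S` is the shadow of `μ` in `ν`. -/
def IsShadow (mu nu S : Measure ℝ) : Prop :=
  Cx mu S ∧ S ≤ nu ∧ ∀ eta : Measure ℝ, Cx mu eta → eta ≤ nu → Cx S eta

/-- `T` is the counter-shadow of `μ` in `ν`. -/
def IsCounterShadow (mu nu T : Measure ℝ) : Prop :=
  Cx mu T ∧ T ≤ nu ∧ ∀ eta : Measure ℝ, Cx mu eta → eta ≤ nu → Cx eta T


lemma convexOn_cont {f : ℝ → ℝ} (hf : ConvexOn ℝ Set.univ f) : Continuous f :=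
  continuousOn_univ.mp (hf.continuousOn isOpen_univ)

lemma convexOn_mid {f : ℝ → ℝ} (hf : ConvexOn ℝ Set.univ f) (x d : ℝ) :
    2 * f x ≤ f (x + d) + f (x - d) := by
  have h := hf.2 (mem_univ (x + d)) (mem_univ (x - d)) (show (0 : ℝ) ≤ 1 / 2 by norm_num)
    (show (0 : ℝ) ≤ 1 / 2 by norm_num) (by norm_num)
  simp only [smul_eq_mul] at h
  have e : 1 / 2 * (x + d) + 1 / 2 * (x - d) = x := by ring
  rw [e] at h
  linarith

/-- Maximum principle on a compact interval. -/
lemma max_principle {V : ℝ → ℝ} (hV : Continuous V) {a b : ℝ} (ha : V a ≤ 0) (hb : V b ≤ 0)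
    (h : ∀ x, 0 < V x → ∃ δ > 0, ∀ d, 0 < d → d < δ → 2 * V x ≤ V (x + d) + V (x - d)) :
    ∀ x ∈ Icc a b, V x ≤ 0 := by
  intro x0 hx0
  by_contra hneg
  push Not at hneg
  obtain ⟨x1, hx1, hmax⟩ := isCompact_Icc.exists_isMaxOn ⟨x0, hx0⟩ hV.continuousOn
  have hmax' : ∀ y ∈ Icc a b, V y ≤ V x1 := fun y hy => hmax hy
  have hpos : 0 < V x1 := lt_of_lt_of_le hneg (hmax' x0 hx0)
  -- rightmost maximizer
  have hcomp : IsCompact (Icc a b ∩ V ⁻¹' {V x1}) :=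
    isCompact_Icc.inter_right (isClosed_singleton.preimage hV)
  obtain ⟨z, hz, hzmax⟩ := hcomp.exists_isMaxOn ⟨x1, hx1, rfl⟩ continuous_id.continuousOn
  have hzV : V z = V x1 := hz.2
  have hzm : ∀ y ∈ Icc a b, V y = V x1 → y ≤ z := fun y hy hy' => hzmax ⟨hy, hy'⟩
  have hza : a < z := by
    rcases eq_or_lt_of_le hz.1.1 with h' | h'
    · rw [← h'] at hzV; linarith
    · exact h'
  have hzb : z < b := by
    rcases eq_or_lt_of_le hz.1.2 with h' | h'
    · rw [h'] at hzV; linarith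
    · exact h'
  obtain ⟨δ, hδ, hd⟩ := h z (by linarith)
  set m := min δ (min (z - a) (b - z)) with hm
  have hmpos : 0 < m := lt_min hδ (lt_min (by linarith) (by linarith))
  have h1 : m ≤ δ := min_le_left _ _
  have h2 : m ≤ z - a := (min_le_right _ _).trans (min_le_left _ _)
  have h3 : m ≤ b - z := (min_le_right _ _).trans (min_le_right _ _)
  have hh := hd (m / 2) (by linarith) (by linarith)
  have e1 := hmax' (z - m / 2) ⟨by linarith, by linarith⟩
  have e2 := hmax' (z + m / 2) ⟨by linarith, by linarith⟩
  have e3 := hzm (z + m / 2) ⟨by linarith, by linarith⟩ (by linarith)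
  linarith

lemma max_principle_top {V : ℝ → ℝ} (hV : Continuous V) (ht : Tendsto V atTop (nhds 0))
    (hb : Tendsto V atBot (nhds 0))
    (h : ∀ x, 0 < V x → ∃ δ > 0, ∀ d, 0 < d → d < δ → 2 * V x ≤ V (x + d) + V (x - d)) :
    ∀ x, V x ≤ 0 := by
  intro x
  by_contra hneg
  push Not at hneg
  obtain ⟨B, hB⟩ := ((ht.eventually (gt_mem_nhds hneg)).and (eventually_ge_atTop x)).exists
  obtain ⟨A, hA⟩ := ((hb.eventually (gt_mem_nhds hneg)).and (eventually_le_atBot x)).exists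
  set e := max 0 (max (V A) (V B)) with he
  have he1 : 0 ≤ e := le_max_left _ _
  have heA : V A ≤ e := (le_max_left _ _).trans (le_max_right _ _)
  have heB : V B ≤ e := (le_max_right _ _).trans (le_max_right _ _)
  have hex : e < V x := max_lt hneg (max_lt hA.1 hB.1)
  have := max_principle (V := fun y => V y - e) (by fun_prop) (a := A) (b := B)
    (by linarith) (by linarith) (by
      intro y hy
      obtain ⟨δ, hδ, hd⟩ := h y (by linarith)
      refine ⟨δ, hδ, fun d h1 h2 => ?_⟩
      have := hd d h1 h2
      linarith) x ⟨hA.2, hB.2⟩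
  linarith

/-- A continuous locally midpoint-convex function is convex. -/
lemma convexOn_of_local_mid {Q : ℝ → ℝ} (hQ : Continuous Q)
    (h : ∀ x, ∃ δ > 0, ∀ d, 0 < d → d < δ → 2 * Q x ≤ Q (x + d) + Q (x - d)) :
    ConvexOn ℝ Set.univ Q := by
  apply LinearOrder.convexOn_of_lt convex_univ
  intro x _ y _ hxy a b ha hb hab
  set s := (Q y - Q x) / (y - x) with hs
  have hyx : y - x ≠ 0 := by linarith
  have hsm : s * (y - x) = Q y - Q x := by rw [hs]; field_simp
  have hab' : a = 1 - b := by linarith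
  have hbyx : 0 ≤ b * (y - x) := mul_nonneg hb.le (by linarith)
  have hayx : 0 ≤ a * (y - x) := mul_nonneg ha.le (by linarith)
  have := max_principle (V := fun t => Q t - (Q x + s * (t - x))) (by fun_prop) (a := x) (b := y)
    (by simp) (by linarith) (by
      intro t _
      obtain ⟨δ, hδ, hd⟩ := h t
      refine ⟨δ, hδ, fun d h1 h2 => ?_⟩
      have := hd d h1 h2
      linarith) (a * x + b * y) ⟨by rw [hab']; linarith, by rw [hab'] at hayx ⊢; linarith⟩
  simp only [smul_eq_mul]
  subst hab'
  have e2 : s * ((1 - b) * x + b * y - x) = b * (Q y - Q x) := by rw [← hsm]; ring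
  rw [e2] at this
  linarith

/-- Existence of the convex hull. -/
lemma exists_hull {f g0 : ℝ → ℝ} (hg0 : ConvexOn ℝ Set.univ g0) (hg0f : ∀ x, g0 x ≤ f x) :
    ∃ c, IsConvexHull f c := by
  let I := {g : ℝ → ℝ // ConvexOn ℝ Set.univ g ∧ ∀ x, g x ≤ f x}
  have : Nonempty I := ⟨⟨g0, hg0, hg0f⟩⟩
  have hbdd : ∀ x, BddAbove (range fun g : I => g.1 x) := by
    intro x
    refine ⟨f x, ?_⟩
    rintro _ ⟨g, rfl⟩
    exact g.2.2 x
  refine ⟨fun x => ⨆ g : I, g.1 x, ⟨convex_univ, ?_⟩, ?_, ?_⟩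
  · intro x _ y _ a b ha hb hab
    apply ciSup_le
    intro g
    refine (g.2.1.2 (mem_univ x) (mem_univ y) ha hb hab).trans ?_
    simp only [smul_eq_mul]
    exact add_le_add (mul_le_mul_of_nonneg_left (le_ciSup (hbdd x) g) ha)
      (mul_le_mul_of_nonneg_left (le_ciSup (hbdd y) g) hb)
  · intro x
    exact ciSup_le fun g => g.2.2 x
  · intro g hg hgf x
    exact le_ciSup (hbdd x) (⟨g, hg, hgf⟩ : I)

lemma hull_local_affine {f c : ℝ → ℝ} (hf : Continuous f) (hc : IsConvexHull f c) {x : ℝ}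
    (hx : c x < f x) :
    ∃ δ > 0, ∀ d, 0 < d → d < δ → c (x + d) + c (x - d) ≤ 2 * c x := by
  have hcc := convexOn_cont hc.1
  set e := (c x + f x) / 2 with he
  have h1 : ∀ᶠ y in nhds x, c y < e := hcc.continuousAt.eventually (gt_mem_nhds (by linarith))
  have h2 : ∀ᶠ y in nhds x, e < f y := hf.continuousAt.eventually (lt_mem_nhds (by linarith))
  obtain ⟨δ, hδ, hd⟩ := Metric.eventually_nhds_iff.mp (h1.and h2)
  refine ⟨δ, hδ, fun d d0 d1 => ?_⟩
  have hin : ∀ y, x - d ≤ y → y ≤ x + d → c y < e ∧ e < f y := by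
    intro y hy1 hy2
    apply hd
    rw [Real.dist_eq, abs_lt]
    constructor <;> linarith
  set s := (c (x + d) - c (x - d)) / (2 * d) with hs
  have hsm : s * (2 * d) = c (x + d) - c (x - d) := by rw [hs]; field_simp
  let l : ℝ → ℝ := fun y => c (x - d) + s * (y - (x - d))
  have hl : ConvexOn ℝ Set.univ l := by
    refine ⟨convex_univ, fun u _ v _ a b ha hb hab => le_of_eq ?_⟩
    simp only [l, smul_eq_mul]
    have : a = 1 - b := by linarith
    subst this
    ring
  have hlR : l (x + d) = c (x + d) := by
    simp only [l]
    have : x + d - (x - d) = 2 * d := by ring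
    rw [this, hsm]; ring
  have hlL : l (x - d) = c (x - d) := by simp [l]
  have hg := hc.2.2 (fun y => max (c y) (l y)) (hc.1.sup hl) (by
    intro y
    apply max_le (hc.2.1 y)
    by_cases hy1 : y < x - d
    · -- left: chord below
      refine le_trans ?_ (hc.2.1 y)
      have := hc.1.slope_mono_adjacent (mem_univ y) (mem_univ (x + d)) hy1 (by linarith)
      rw [div_le_div_iff₀ (by linarith) (by linarith)] at this
      have e1 : x + d - (x - d) = 2 * d := by ring
      rw [e1, ← hsm] at this
      have := le_of_mul_le_mul_right (a := 2 * d) (b := c (x - d) - c y)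
        (c := s * (x - d - y)) (by linarith) (by linarith)
      simp only [l]
      linarith
    · by_cases hy2 : x + d < y
      · refine le_trans ?_ (hc.2.1 y)
        have := hc.1.slope_mono_adjacent (mem_univ (x - d)) (mem_univ y)
          (y := x + d) (by linarith) hy2
        rw [div_le_div_iff₀ (by linarith) (by linarith)] at this
        have e1 : x + d - (x - d) = 2 * d := by ring
        rw [e1, ← hsm] at this
        have := le_of_mul_le_mul_right (a := 2 * d) (c := c y - c (x + d))
          (b := s * (y - (x + d))) (by linarith) (by linarith)
        simp only [l]
        linarith
      · push Not at hy1 hy2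
        have hfy := (hin y hy1 hy2).2
        have a1 := (hin (x - d) (by linarith) (by linarith)).1
        have a2 := (hin (x + d) (by linarith) (by linarith)).1
        have : l y ≤ e := by
          simp only [l]
          by_cases hs0 : 0 ≤ s
          · nlinarith
          · push Not at hs0
            nlinarith
        linarith) x
  have hlx : l x ≤ c x := (le_max_right _ _).trans hg
  simp only [l] at hlx
  have : x - (x - d) = d := by ring
  rw [this] at hlx
  linarith

lemma integrable_pot {η : Measure ℝ} [IsFiniteMeasure η] (h : Integrable (fun x => x) η) (k : ℝ) :
    Integrable (fun x => max (k - x) 0) η :=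
  ((integrable_const k).sub h).pos_part

lemma integrable_cpot {η : Measure ℝ} [IsFiniteMeasure η] (h : Integrable (fun x => x) η) (k : ℝ) :
    Integrable (fun x => max (x - k) 0) η :=
  (h.sub (integrable_const k)).pos_part

lemma convexOn_aff (a b : ℝ) : ConvexOn ℝ Set.univ (fun x : ℝ => a * x + b) := by
  refine ⟨convex_univ, fun u _ v _ s t hs ht hst => le_of_eq ?_⟩
  simp only [smul_eq_mul]
  have : s = 1 - t := by linarith
  subst this
  ring

lemma convexOn_put (k : ℝ) : ConvexOn ℝ Set.univ (fun x : ℝ => max (k - x) 0) := by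
  have := (convexOn_aff (-1) k).sup (convexOn_aff 0 0)
  refine this.congr ?_
  intro x _
  simp only [Pi.sup_apply]
  congr 1 <;> ring

lemma convexOn_pot {η : Measure ℝ} (h : ∀ k, Integrable (fun x => max (k - x) 0) η) :
    ConvexOn ℝ Set.univ (pot η) := by
  refine ⟨convex_univ, fun u _ v _ a b ha hb hab => ?_⟩
  simp only [pot, smul_eq_mul]
  rw [← integral_const_mul, ← integral_const_mul,
    ← integral_add ((h u).const_mul a) ((h v).const_mul b)]
  refine integral_mono (h _) (((h u).const_mul a).add ((h v).const_mul b)) fun x => ?_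
  have h1 : u - x ≤ max (u - x) 0 := le_max_left _ _
  have h2 : v - x ≤ max (v - x) 0 := le_max_left _ _
  have h3 : 0 ≤ max (u - x) 0 := le_max_right _ _
  have h4 : 0 ≤ max (v - x) 0 := le_max_right _ _
  apply max_le
  · have : a * u + b * v - x = a * (u - x) + b * (v - x) := by
      have : a = 1 - b := by linarith
      subst this
      ring
    rw [this]
    exact add_le_add (mul_le_mul_of_nonneg_left h1 ha) (mul_le_mul_of_nonneg_left h2 hb)
  · positivity

lemma pot_nonneg (η : Measure ℝ) (k : ℝ) : 0 ≤ pot η k :=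
  integral_nonneg fun _ => le_max_right _ _

lemma pot_tendsto_atBot {η : Measure ℝ} [IsFiniteMeasure η] (h : Integrable (fun x => x) η) :
    Tendsto (pot η) atBot (nhds 0) := by
  have : Tendsto (fun k => ∫ x, max (k - x) 0 ∂η) atBot (nhds (∫ _, (0 : ℝ) ∂η)) := by
    refine tendsto_integral_filter_of_dominated_convergence (fun x => max (0 - x) 0) ?_ ?_
      (integrable_pot h 0) ?_
    · exact Eventually.of_forall fun k => (integrable_pot h k).aestronglyMeasurable
    · filter_upwards [eventually_le_atBot 0] with k hk
      refine Eventually.of_forall fun x => ?_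
      rw [Real.norm_of_nonneg (le_max_right _ _)]
      exact max_le_max (by linarith) le_rfl
    · refine Eventually.of_forall fun x => ?_
      refine tendsto_const_nhds.congr' ?_
      filter_upwards [eventually_le_atBot x] with k hk
      rw [max_eq_right (by linarith)]
  rw [integral_zero] at this
  exact this

lemma cpot_tendsto_atTop {η : Measure ℝ} [IsFiniteMeasure η] (h : Integrable (fun x => x) η) :
    Tendsto (cpot η) atTop (nhds 0) := by
  have : Tendsto (fun k => ∫ x, max (x - k) 0 ∂η) atTop (nhds (∫ _, (0 : ℝ) ∂η)) := by
    refine tendsto_integral_filter_of_dominated_convergence (fun x => max (x - 0) 0) ?_ ?_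
      (integrable_cpot h 0) ?_
    · exact Eventually.of_forall fun k => (integrable_cpot h k).aestronglyMeasurable
    · filter_upwards [eventually_ge_atTop 0] with k hk
      refine Eventually.of_forall fun x => ?_
      rw [Real.norm_of_nonneg (le_max_right _ _)]
      exact max_le_max (by linarith) le_rfl
    · refine Eventually.of_forall fun x => ?_
      refine tendsto_const_nhds.congr' ?_
      filter_upwards [eventually_ge_atTop x] with k hk
      rw [max_eq_right (by linarith)]
  rw [integral_zero] at this
  exact this

lemma pot_sub_cpot {η : Measure ℝ} [IsFiniteMeasure η] (h : Integrable (fun x => x) η) (k : ℝ) :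
    pot η k = cpot η k + (η.real univ * k - ∫ x, x ∂η) := by
  have h1 : ∫ x, (k - x) ∂η = η.real univ * k - ∫ x, x ∂η := by
    rw [integral_sub (integrable_const k) h]; simp
  have h2 : Integrable (fun x => k - x) η := (integrable_const k).sub h
  rw [← h1, pot, cpot, ← integral_add (integrable_cpot h k) h2]
  congr 1
  ext x
  rcases le_total x k with hx | hx
  · rw [max_eq_left (by linarith), max_eq_right (by linarith)]; simp
  · rw [max_eq_right (by linarith), max_eq_left (by linarith)]; simp

/-- Measures with equal (finite) potentials coincide. -/
lemma eq_of_pot_eq {α β : Measure ℝ} [IsFiniteMeasure α] [IsFiniteMeasure β]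
    (ha : ∀ k, Integrable (fun x => max (k - x) 0) α)
    (hb : ∀ k, Integrable (fun x => max (k - x) 0) β)
    (h : ∀ k, pot α k = pot β k) : α = β := by
  have key : ∀ (η : Measure ℝ) [IsFiniteMeasure η],
      (∀ k, Integrable (fun x => max (k - x) 0) η) → ∀ t,
      Tendsto (fun n : ℕ => ((n : ℝ) + 1) * (pot η (t + 1 / ((n : ℝ) + 1)) - pot η t)) atTop
        (nhds (η.real (Iic t))) := by
    intro η _ hη t
    have e1 : η.real (Iic t) = ∫ x, (Iic t).indicator (fun _ => (1 : ℝ)) x ∂η := by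
      rw [integral_indicator measurableSet_Iic]; simp
    rw [e1]
    have e2 : ∀ n : ℕ, ((n : ℝ) + 1) * (pot η (t + 1 / ((n : ℝ) + 1)) - pot η t)
        = ∫ x, ((n : ℝ) + 1) * (max (t + 1 / ((n : ℝ) + 1) - x) 0 - max (t - x) 0) ∂η := by
      intro n
      rw [integral_const_mul, integral_sub (hη _) (hη _)]
      rfl
    simp_rw [e2]
    refine tendsto_integral_of_dominated_convergence (fun _ => (1 : ℝ)) ?_ (integrable_const _) ?_ ?_
    · intro n
      exact (((hη _).sub (hη _)).const_mul _).aestronglyMeasurable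
    · intro n
      refine Eventually.of_forall fun x => ?_
      have hn : (0 : ℝ) < (n : ℝ) + 1 := by positivity
      have hn' : (0 : ℝ) < 1 / ((n : ℝ) + 1) := by positivity
      have hm : max (t - x) 0 ≤ max (t + 1 / ((n : ℝ) + 1) - x) 0 :=
        max_le_max (by linarith) le_rfl
      have hm2 : max (t + 1 / ((n : ℝ) + 1) - x) 0 ≤ max (t - x) 0 + 1 / ((n : ℝ) + 1) :=
        max_le (by linarith [le_max_left (t - x) 0]) (by linarith [le_max_right (t - x) 0])
      rw [Real.norm_of_nonneg (mul_nonneg hn.le (by linarith))]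
      calc _ ≤ ((n : ℝ) + 1) * (1 / ((n : ℝ) + 1)) :=
            mul_le_mul_of_nonneg_left (by linarith) hn.le
        _ = 1 := by field_simp
    · refine Eventually.of_forall fun x => ?_
      by_cases hx : x ≤ t
      · rw [indicator_of_mem (show x ∈ Iic t from hx)]
        refine tendsto_const_nhds.congr fun n => ?_
        have hn : (0 : ℝ) < (n : ℝ) + 1 := by positivity
        have hn' : (0 : ℝ) < 1 / ((n : ℝ) + 1) := by positivity
        rw [max_eq_left (by linarith), max_eq_left (by linarith)]
        field_simp
        ring
      · rw [indicator_of_notMem (show x ∉ Iic t from hx)]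
        push Not at hx
        refine tendsto_const_nhds.congr' ?_
        have := tendsto_one_div_add_atTop_nhds_zero_nat (𝕜 := ℝ)
        filter_upwards [this.eventually (gt_mem_nhds (show (0 : ℝ) < x - t by linarith))] with n hn
        rw [max_eq_right (by linarith), max_eq_right (by linarith)]
        simp
  refine Measure.ext_of_Iic α β fun t => ?_
  have h1 := key α ha t
  have h2 := key β hb t
  simp_rw [h] at h1
  have := tendsto_nhds_unique h1 h2
  rwa [measureReal_eq_measureReal_iff] at this

lemma tonelli_put (η : Measure ℝ) [SFinite η] (k : ℝ) :
    ∫⁻ x, ENNReal.ofReal (max (k - x) 0) ∂η = ∫⁻ t in Iio k, η (Iic t) := by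
  have hm : MeasurableSet {p : ℝ × ℝ | p.1 ≤ p.2} := measurableSet_le measurable_fst measurable_snd
  have e1 : ∀ t, η (Iic t) = ∫⁻ x, ({p : ℝ × ℝ | p.1 ≤ p.2}.indicator 1 (x, t)) ∂η := by
    intro t
    rw [← lintegral_indicator_one measurableSet_Iic]
    rfl
  simp_rw [e1]
  rw [lintegral_lintegral_swap]
  · congr 1
    ext x
    have : ∀ t, ({p : ℝ × ℝ | p.1 ≤ p.2}.indicator (1 : ℝ × ℝ → ENNReal) (x, t))
        = (Ici x).indicator 1 t := fun t => rfl
    simp_rw [this]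
    rw [lintegral_indicator_one measurableSet_Ici, Measure.restrict_apply measurableSet_Ici,
      Ici_inter_Iio, Real.volume_Ico]
    rcases le_total x k with hx | hx
    · rw [max_eq_left (by linarith)]
    · rw [max_eq_right (by linarith), ENNReal.ofReal_zero, ENNReal.ofReal_of_nonpos (by linarith)]
  · have : Measurable ({p : ℝ × ℝ | p.1 ≤ p.2}.indicator (1 : ℝ × ℝ → ENNReal)) :=
      measurable_one.indicator hm
    exact (this.comp measurable_swap).aemeasurable

lemma tonelli_call (η : Measure ℝ) [SFinite η] (k : ℝ) :
    ∫⁻ x, ENNReal.ofReal (max (x - k) 0) ∂η = ∫⁻ t in Ici k, η (Ioi t) := by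
  have hm : MeasurableSet {p : ℝ × ℝ | p.2 < p.1} := measurableSet_lt measurable_snd measurable_fst
  have e1 : ∀ t, η (Ioi t) = ∫⁻ x, ({p : ℝ × ℝ | p.2 < p.1}.indicator 1 (x, t)) ∂η := by
    intro t
    rw [← lintegral_indicator_one measurableSet_Ioi]
    rfl
  simp_rw [e1]
  rw [lintegral_lintegral_swap]
  · congr 1
    ext x
    have : ∀ t, ({p : ℝ × ℝ | p.2 < p.1}.indicator (1 : ℝ × ℝ → ENNReal) (x, t))
        = (Iio x).indicator 1 t := fun t => rfl
    simp_rw [this]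
    rw [lintegral_indicator_one measurableSet_Iio, Measure.restrict_apply measurableSet_Iio,
      inter_comm, Ici_inter_Iio, Real.volume_Ico]
    rcases le_total x k with hx | hx
    · rw [max_eq_right (by linarith), ENNReal.ofReal_zero, ENNReal.ofReal_of_nonpos (by linarith)]
    · rw [max_eq_left (by linarith)]
  · have : Measurable ({p : ℝ × ℝ | p.2 < p.1}.indicator (1 : ℝ × ℝ → ENNReal)) :=
      measurable_one.indicator hm
    exact (this.comp measurable_swap).aemeasurable

lemma exists_stieltjes {Q : ℝ → ℝ} (hQ : ConvexOn ℝ Set.univ Q) :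
    ∃ g : StieltjesFunction ℝ, ∀ a b, ∫ t in a..b, g t = Q b - Q a := by
  have hmono : Monotone (fun x => derivWithin Q (Ioi x) x) := by
    have := hQ.monotoneOn_rightDeriv
    rw [interior_univ] at this
    exact monotoneOn_univ.mp this
  refine ⟨hmono.stieltjesFunction, fun a b => ?_⟩
  have h1 : ∫ t in a..b, derivWithin Q (Ioi t) t = Q b - Q a := by
    apply intervalIntegral.integral_eq_sub_of_hasDeriv_right (convexOn_cont hQ).continuousOn
    · intro x _
      exact hQ.hasDerivWithinAt_rightDeriv_of_mem_interior (by simp)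
    · exact hmono.intervalIntegrable
  rw [← h1]
  apply intervalIntegral.integral_congr_ae
  have hc := hmono.countable_not_continuousAt
  have := hc.ae_notMem volume
  filter_upwards [this] with x hx _
  have hx := not_not.mp hx
  rw [hmono.stieltjesFunction_eq]
  exact hx.continuousWithinAt.rightLim_eq

lemma stieltjes_intervalIntegrable (g : StieltjesFunction ℝ) (a b : ℝ) :
    IntervalIntegrable g volume a b := g.mono.intervalIntegrable

lemma taylor_nonneg {f : ℝ → ℝ} {g : StieltjesFunction ℝ}
    (hg : ∀ a b, ∫ t in a..b, g t = f b - f a) (y : ℝ) : 0 ≤ f y - f 0 - g 0 * y := by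
  rw [← hg 0 y]
  rcases le_total 0 y with hy | hy
  · have : ∫ t in (0 : ℝ)..y, g 0 ≤ ∫ t in (0 : ℝ)..y, g t :=
      intervalIntegral.integral_mono_on hy (by simp) (stieltjes_intervalIntegrable g _ _)
        fun t ht => g.mono ht.1
    rw [intervalIntegral.integral_const, smul_eq_mul] at this
    linarith
  · have : ∫ t in y..0, g t ≤ ∫ t in y..0, g 0 :=
      intervalIntegral.integral_mono_on hy (stieltjes_intervalIntegrable g _ _) (by simp)
        fun t ht => g.mono ht.2
    rw [intervalIntegral.integral_const, smul_eq_mul] at this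
    rw [intervalIntegral.integral_symm]
    linarith

lemma taylor {f : ℝ → ℝ} {g : StieltjesFunction ℝ}
    (hg : ∀ a b, ∫ t in a..b, g t = f b - f a) (y : ℝ) :
    ENNReal.ofReal (f y - f 0 - g 0 * y)
      = ∫⁻ k in Ioi 0, ENNReal.ofReal (max (y - k) 0) ∂g.measure
        + ∫⁻ k in Iic 0, ENNReal.ofReal (max (k - y) 0) ∂g.measure := by
  rw [tonelli_put, tonelli_call]
  have e1 : ∀ t, g.measure.restrict (Ioi 0) (Iic t) = ENNReal.ofReal (g t - g 0) := by
    intro t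
    rw [Measure.restrict_apply measurableSet_Iic, inter_comm, Ioi_inter_Iic, g.measure_Ioc]
  have e2 : ∀ t, g.measure.restrict (Iic 0) (Ioi t) = ENNReal.ofReal (g 0 - g t) := by
    intro t
    rw [Measure.restrict_apply measurableSet_Ioi, Ioi_inter_Iic, g.measure_Ioc]
  simp_rw [e1, e2]
  rcases le_total 0 y with hy | hy
  · have z2 : ∫⁻ t in Ici y, ENNReal.ofReal (g 0 - g t) = 0 := by
      rw [setLIntegral_congr_fun (g := fun _ => 0) measurableSet_Ici]
      · simp
      · intro t ht
        exact ENNReal.ofReal_of_nonpos (by linarith [g.mono (le_trans hy ht)])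
    have z1 : ∫⁻ t in Iic 0, ENNReal.ofReal (g t - g 0) = 0 := by
      rw [setLIntegral_congr_fun (g := fun _ => 0) measurableSet_Iic]
      · simp
      · intro t ht
        exact ENNReal.ofReal_of_nonpos (by linarith [g.mono (show t ≤ 0 from ht)])
    rw [z2, add_zero, setLIntegral_congr Iio_ae_eq_Iic, ← Iic_union_Ioc_eq_Iic hy,
      lintegral_union measurableSet_Ioc (Iic_disjoint_Ioc le_rfl), z1, zero_add,
      ← ofReal_integral_eq_lintegral_ofReal]
    · rw [← intervalIntegral.integral_of_le hy, intervalIntegral.integral_sub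
        (stieltjes_intervalIntegrable g _ _) (by simp), hg]
      simp [mul_comm]
    · exact ((stieltjes_intervalIntegrable g 0 y).sub (by simp)).1
    · refine (ae_restrict_mem measurableSet_Ioc).mono fun t ht => ?_
      simp only [Pi.zero_apply]
      linarith [g.mono ht.1.le]
  · have z1 : ∫⁻ t in Iio y, ENNReal.ofReal (g t - g 0) = 0 := by
      rw [setLIntegral_congr_fun (g := fun _ => 0) measurableSet_Iio]
      · simp
      · intro t ht
        exact ENNReal.ofReal_of_nonpos (by linarith [g.mono (le_trans (le_of_lt ht) hy)])
    have z2 : ∫⁻ t in Ioi 0, ENNReal.ofReal (g 0 - g t) = 0 := by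
      rw [setLIntegral_congr_fun (g := fun _ => 0) measurableSet_Ioi]
      · simp
      · intro t ht
        exact ENNReal.ofReal_of_nonpos (by linarith [g.mono (le_of_lt (show 0 < t from ht))])
    rw [z1, zero_add, setLIntegral_congr Ioi_ae_eq_Ici.symm, ← Ioc_union_Ioi_eq_Ioi hy,
      lintegral_union measurableSet_Ioi (Ioc_disjoint_Ioi le_rfl), z2, add_zero,
      ← ofReal_integral_eq_lintegral_ofReal]
    · rw [← intervalIntegral.integral_of_le hy, intervalIntegral.integral_sub
        (by simp) (stieltjes_intervalIntegrable g _ _), hg]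
      simp only [intervalIntegral.integral_const, smul_eq_mul]
      congr 1
      ring
    · exact (IntervalIntegrable.sub (by simp) (stieltjes_intervalIntegrable g y 0)).1
    · refine (ae_restrict_mem measurableSet_Ioc).mono fun t ht => ?_
      simp only [Pi.zero_apply]
      linarith [g.mono ht.2]

lemma taylor_lintegral {f : ℝ → ℝ} {g : StieltjesFunction ℝ}
    (hg : ∀ a b, ∫ t in a..b, g t = f b - f a) (α : Measure ℝ) [IsFiniteMeasure α]
    (ha : Integrable (fun x => x) α) :
    ∫⁻ y, ENNReal.ofReal (f y - f 0 - g 0 * y) ∂α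
      = ∫⁻ k in Ioi 0, ENNReal.ofReal (cpot α k) ∂g.measure
        + ∫⁻ k in Iic 0, ENNReal.ofReal (pot α k) ∂g.measure := by
  simp_rw [taylor hg]
  have m1 : Measurable (fun p : ℝ × ℝ => ENNReal.ofReal (max (p.1 - p.2) 0)) := by fun_prop
  have m2 : Measurable (fun p : ℝ × ℝ => ENNReal.ofReal (max (p.2 - p.1) 0)) := by fun_prop
  have s1 : ∫⁻ y, ∫⁻ k in Ioi 0, ENNReal.ofReal (max (y - k) 0) ∂g.measure ∂α
      = ∫⁻ k in Ioi 0, ENNReal.ofReal (cpot α k) ∂g.measure := by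
    rw [lintegral_lintegral_swap m1.aemeasurable]
    refine lintegral_congr fun k => ?_
    exact (ofReal_integral_eq_lintegral_ofReal (integrable_cpot ha k)
      (Eventually.of_forall fun _ => le_max_right _ _)).symm
  have s2 : ∫⁻ y, ∫⁻ k in Iic 0, ENNReal.ofReal (max (k - y) 0) ∂g.measure ∂α
      = ∫⁻ k in Iic 0, ENNReal.ofReal (pot α k) ∂g.measure := by
    rw [lintegral_lintegral_swap m2.aemeasurable]
    refine lintegral_congr fun k => ?_
    exact (ofReal_integral_eq_lintegral_ofReal (integrable_pot ha k)
      (Eventually.of_forall fun _ => le_max_right _ _)).symm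
  rw [← s1, ← s2]
  exact lintegral_add_left (Measurable.lintegral_prod_right' m1) _

lemma cx_strong {α β : Measure ℝ} [IsFiniteMeasure α] [IsFiniteMeasure β]
    (ha : Integrable (fun x => x) α) (hb : Integrable (fun x => x) β)
    (hmass : α.real univ = β.real univ) (hmean : ∫ x, x ∂α = ∫ x, x ∂β)
    (hpot : ∀ k, pot α k ≤ pot β k) {f : ℝ → ℝ} (hf : ConvexOn ℝ Set.univ f)
    (hfb : Integrable f β) : Integrable f α ∧ ∫ x, f x ∂α ≤ ∫ x, f x ∂β := by
  obtain ⟨g, hg⟩ := exists_stieltjes hf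
  have hcpot : ∀ k, cpot α k ≤ cpot β k := by
    intro k
    have := hpot k
    rw [pot_sub_cpot ha, pot_sub_cpot hb, hmass, hmean] at this
    linarith
  have hle : ∫⁻ y, ENNReal.ofReal (f y - f 0 - g 0 * y) ∂α
      ≤ ∫⁻ y, ENNReal.ofReal (f y - f 0 - g 0 * y) ∂β := by
    rw [taylor_lintegral hg α ha, taylor_lintegral hg β hb]
    exact add_le_add (lintegral_mono fun k => ENNReal.ofReal_le_ofReal (hcpot k))
      (lintegral_mono fun k => ENNReal.ofReal_le_ofReal (hpot k))
  have affa : Integrable (fun y => f 0 + g 0 * y) α := (integrable_const _).add (ha.const_mul _)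
  have affb : Integrable (fun y => f 0 + g 0 * y) β := (integrable_const _).add (hb.const_mul _)
  have hTb : Integrable (fun y => f y - f 0 - g 0 * y) β :=
    (hfb.sub (integrable_const (f 0))).sub (hb.const_mul (g 0))
  have hnn := taylor_nonneg hg
  have hfin : ∫⁻ y, ENNReal.ofReal (f y - f 0 - g 0 * y) ∂β ≠ ⊤ := hTb.lintegral_lt_top.ne
  have hfc := convexOn_cont hf
  have hTa : Integrable (fun y => f y - f 0 - g 0 * y) α := by
    refine ⟨(by fun_prop : Continuous fun y => f y - f 0 - g 0 * y).aestronglyMeasurable, ?_⟩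
    rw [hasFiniteIntegral_iff_ofReal (Eventually.of_forall hnn)]
    exact lt_of_le_of_lt hle hTb.lintegral_lt_top
  have hTint : ∫ y, (f y - f 0 - g 0 * y) ∂α ≤ ∫ y, (f y - f 0 - g 0 * y) ∂β := by
    rw [integral_eq_lintegral_of_nonneg_ae (Eventually.of_forall hnn) hTa.aestronglyMeasurable,
      integral_eq_lintegral_of_nonneg_ae (Eventually.of_forall hnn) hTb.aestronglyMeasurable]
    exact ENNReal.toReal_mono hfin hle
  have hsplit : f = fun y => (f y - f 0 - g 0 * y) + (f 0 + g 0 * y) := by ext y; ring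
  have ia : ∫ y, (f 0 + g 0 * y) ∂α = ∫ y, (f 0 + g 0 * y) ∂β := by
    rw [integral_add (integrable_const _) (ha.const_mul _),
      integral_add (integrable_const _) (hb.const_mul _), integral_const_mul, integral_const_mul,
      hmean]
    simp [hmass]
  have hfa : Integrable f α := by
    rw [hsplit]; exact hTa.add affa
  refine ⟨hfa, ?_⟩
  have i1 : ∫ y, f y ∂α = ∫ y, (f y - f 0 - g 0 * y) ∂α + ∫ y, (f 0 + g 0 * y) ∂α := by
    rw [← integral_add hTa affa]; congr 1
  have i2 : ∫ y, f y ∂β = ∫ y, (f y - f 0 - g 0 * y) ∂β + ∫ y, (f 0 + g 0 * y) ∂β := by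
    rw [← integral_add hTb affb]; congr 1
  linarith

/-- Realization of a convex function as a potential. -/
lemma exists_measure_pot {Q P : ℝ → ℝ} (hQ : ConvexOn ℝ Set.univ Q) (h0 : ∀ x, 0 ≤ Q x)
    (hQP : ∀ x, Q x ≤ P x) (hP : Tendsto P atBot (nhds 0)) {M b : ℝ}
    (hPM : ∀ x, 0 ≤ x → P x ≤ M * x + b) :
    ∃ η : Measure ℝ, IsFiniteMeasure η ∧ (∀ k, Integrable (fun x => max (k - x) 0) η) ∧
      ∀ k, pot η k = Q k := by
  obtain ⟨g, hg⟩ := exists_stieltjes hQ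
  have hQ0 : Tendsto Q atBot (nhds 0) :=
    tendsto_of_tendsto_of_tendsto_of_le_of_le tendsto_const_nhds hP h0 hQP
  have lo : ∀ s t, s ≤ t → g s * (t - s) ≤ Q t - Q s := by
    intro s t hst
    rw [← hg s t]
    have : ∫ u in s..t, g s ≤ ∫ u in s..t, g u :=
      intervalIntegral.integral_mono_on hst (by simp) (stieltjes_intervalIntegrable g _ _)
        fun u hu => g.mono hu.1
    rw [intervalIntegral.integral_const, smul_eq_mul] at this
    linarith
  have hi : ∀ s t, s ≤ t → Q t - Q s ≤ g t * (t - s) := by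
    intro s t hst
    rw [← hg s t]
    have : ∫ u in s..t, g u ≤ ∫ u in s..t, g t :=
      intervalIntegral.integral_mono_on hst (stieltjes_intervalIntegrable g _ _) (by simp)
        fun u hu => g.mono hu.2
    rw [intervalIntegral.integral_const, smul_eq_mul] at this
    linarith
  have gnn : ∀ t, 0 ≤ g t := by
    intro t
    by_contra hneg
    push Not at hneg
    have := (hQ0.eventually (gt_mem_nhds (show (0 : ℝ) < 1 by norm_num))).and
      ((eventually_le_atBot t).and (eventually_le_atBot (t - 2 / (- g t))))
    obtain ⟨s, hs1, hs2, hs3⟩ := this.exists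
    have h1 := hi s t hs2
    have h2 : 2 / (- g t) ≤ t - s := by linarith
    rw [div_le_iff₀ (by linarith)] at h2
    have := h0 t
    linarith
  have gle : ∀ t, g t ≤ M := by
    intro t
    by_contra hneg
    push Not at hneg
    set e := g t - M with he
    have hepos : 0 < e := by linarith
    obtain ⟨s, hs1, hs2, hs3⟩ := ((eventually_ge_atTop t).and ((eventually_ge_atTop 0).and
      (eventually_gt_atTop ((b + g t * t) / e)))).exists
    have h1 := lo t s hs1
    have h2 := hQP s
    have h3 := hPM s hs2
    have h4 := h0 t
    rw [div_lt_iff₀ hepos] at hs3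
    have : s * e = s * g t - s * M := by rw [he]; ring
    linarith
  have glim : Tendsto g atBot (nhds 0) := by
    have h1 : Tendsto (fun t => Q (t + 1)) atBot (nhds 0) :=
      hQ0.comp (tendsto_atBot_add_const_right _ 1 tendsto_id)
    refine tendsto_of_tendsto_of_tendsto_of_le_of_le tendsto_const_nhds h1 gnn fun t => ?_
    have := lo t (t + 1) (by linarith)
    have := h0 t
    simp only
    linarith
  have hfin : IsFiniteMeasure g.measure :=
    g.isFiniteMeasure_of_forall_abs_le (C := M) fun x => by rw [abs_of_nonneg (gnn x)]; exact gle x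
  have hint : ∀ k, IntegrableOn g (Iic k) ∧ ∫ t in Iic k, g t = Q k := by
    intro k
    have hlim : Tendsto (fun a => ∫ t in a..k, g t) atBot (nhds (Q k)) := by
      simp_rw [hg]
      simpa using tendsto_const_nhds.sub hQ0
    have hI : IntegrableOn g (Iic k) := by
      refine integrableOn_Iic_of_intervalIntegral_norm_tendsto (Q k) k (a := fun a : ℝ => a)
        (l := atBot) ?_ tendsto_id ?_
      · intro a
        exact (stieltjes_intervalIntegrable g a k).1
      · refine hlim.congr fun a => ?_
        congr 1
        ext t
        rw [Real.norm_of_nonneg (gnn t)]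
    exact ⟨hI, tendsto_nhds_unique (intervalIntegral_tendsto_integral_Iic k hI tendsto_id) hlim⟩
  have hL : ∀ k, ∫⁻ x, ENNReal.ofReal (max (k - x) 0) ∂g.measure = ENNReal.ofReal (Q k) := by
    intro k
    rw [tonelli_put]
    simp_rw [g.measure_Iic glim, sub_zero]
    rw [setLIntegral_congr Iio_ae_eq_Iic, ← (hint k).2,
      ofReal_integral_eq_lintegral_ofReal (hint k).1 (Eventually.of_forall gnn)]
  have hmx : ∀ k, 0 ≤ᵐ[g.measure] fun x => max (k - x) 0 :=
    fun k => Eventually.of_forall fun _ => le_max_right _ _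
  have hI : ∀ k, Integrable (fun x => max (k - x) 0) g.measure := by
    intro k
    refine ⟨(by fun_prop : Continuous fun x : ℝ => max (k - x) 0).aestronglyMeasurable, ?_⟩
    rw [hasFiniteIntegral_iff_ofReal (hmx k), hL]
    exact ENNReal.ofReal_lt_top
  refine ⟨g.measure, hfin, hI, fun k => ?_⟩
  rw [pot, integral_eq_lintegral_of_nonneg_ae (hmx k)
    (hI k).aestronglyMeasurable, hL, ENNReal.toReal_ofReal (h0 k)]

lemma pot_add {α β : Measure ℝ} (ha : ∀ k, Integrable (fun x => max (k - x) 0) α)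
    (hb : ∀ k, Integrable (fun x => max (k - x) 0) β) (k : ℝ) :
    pot (α + β) k = pot α k + pot β k := integral_add_measure (ha k) (hb k)

lemma convexOn_pot_sub {S nu : Measure ℝ} [IsFiniteMeasure nu] (hn : Integrable (fun x => x) nu)
    (h : S ≤ nu) : ConvexOn ℝ Set.univ (fun x => pot nu x - pot S x) := by
  have : IsFiniteMeasure S := isFiniteMeasure_of_le nu h
  have e : nu - S + S = nu := Measure.sub_add_cancel_of_le h
  have hd : nu - S ≤ nu := Measure.sub_le
  have i1 := integrable_pot (hn.mono_measure h)
  have i2 : ∀ k, Integrable (fun x => max (k - x) 0) (nu - S) :=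
    fun k => (integrable_pot hn k).mono_measure hd
  have : (fun x => pot nu x - pot S x) = pot (nu - S) := by
    ext x
    nth_rewrite 1 [← e]
    rw [pot_add i2 i1]
    ring
  rw [this]
  exact convexOn_pot i2

lemma cx_facts {α β : Measure ℝ} [IsFiniteMeasure α] [IsFiniteMeasure β]
    (ha : Integrable (fun x => x) α) (hb : Integrable (fun x => x) β) (h : Cx α β) :
    (∀ k, pot α k ≤ pot β k) ∧ α.real univ = β.real univ ∧ ∫ x, x ∂α = ∫ x, x ∂β := by
  refine ⟨fun k => h _ (convexOn_put k) (integrable_pot ha k) (integrable_pot hb k), ?_, ?_⟩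
  · have h1 := h _ (convexOn_aff 0 1) (by simp) (by simp)
    have h2 := h _ (convexOn_aff 0 (-1)) (by simp) (by simp)
    simp at h1 h2
    linarith
  · have h1 := h _ (convexOn_aff 1 0) (by simpa using ha) (by simpa using hb)
    have h2 := h _ (convexOn_aff (-1) 0) ((ha.const_mul _).add (integrable_const _))
      ((hb.const_mul _).add (integrable_const _))
    simp only [add_zero, neg_mul, one_mul] at h1 h2
    have e : ∀ η : Measure ℝ, ∫ x : ℝ, -x ∂η = - ∫ x : ℝ, x ∂η := fun η => MeasureTheory.integral_neg _
    rw [e, e] at h2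
    linarith

lemma W_tendsto {α β : Measure ℝ} [IsFiniteMeasure α] [IsFiniteMeasure β]
    (ha : Integrable (fun x => x) α) (hb : Integrable (fun x => x) β)
    (hmass : α.real univ = β.real univ) (hmean : ∫ x, x ∂α = ∫ x, x ∂β) :
    Tendsto (fun k => pot β k - pot α k) atTop (nhds 0) ∧
      Tendsto (fun k => pot β k - pot α k) atBot (nhds 0) := by
  constructor
  · have : (fun k => pot β k - pot α k) = fun k => cpot β k - cpot α k := by
      ext k
      rw [pot_sub_cpot ha, pot_sub_cpot hb, hmass, hmean]
      ring
    rw [this]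
    simpa using (cpot_tendsto_atTop hb).sub (cpot_tendsto_atTop ha)
  · simpa using (pot_tendsto_atBot hb).sub (pot_tendsto_atBot ha)

lemma aff_tendsto {A B : ℝ} (h : Tendsto (fun k : ℝ => A * k - B) atTop (nhds 0)) :
    A = 0 ∧ B = 0 := by
  have h1 : Tendsto (fun k : ℝ => A * (k + 1) - B) atTop (nhds 0) :=
    h.comp (tendsto_atTop_add_const_right _ 1 tendsto_id)
  have h2 : Tendsto (fun _ : ℝ => A) atTop (nhds 0) := by
    have := h1.sub h
    rw [sub_zero] at this
    refine this.congr fun k => ?_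
    ring
  have hA : A = 0 := tendsto_nhds_unique tendsto_const_nhds h2
  subst hA
  have h3 : Tendsto (fun _ : ℝ => - B) atTop (nhds 0) := h.congr fun k => by ring
  have := tendsto_nhds_unique tendsto_const_nhds h3
  exact ⟨rfl, by linarith⟩

lemma keyA {mu nu S : Measure ℝ} [IsFiniteMeasure mu] [IsFiniteMeasure nu]
    (hm : Integrable (fun x => x) mu) (hn : Integrable (fun x => x) nu) (hS : IsShadow mu nu S)
    {x : ℝ} (hx : pot mu x < pot S x) :
    ∃ δ > 0, ∀ d, 0 < d → d < δ →
      (pot nu (x + d) - pot S (x + d)) + (pot nu (x - d) - pot S (x - d))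
        ≤ 2 * (pot nu x - pot S x) := by
  obtain ⟨hcx, hle, hmin⟩ := hS
  have : IsFiniteMeasure S := isFiniteMeasure_of_le nu hle
  have hSi : Integrable (fun x => x) S := hn.mono_measure hle
  obtain ⟨hp, hmass, hmean⟩ := cx_facts hm hSi hcx
  have hpm := convexOn_pot (integrable_pot hm)
  have hpn := convexOn_pot (integrable_pot hn)
  have hc0 := convexOn_pot_sub hn hle
  have hpSn : ∀ x, pot S x ≤ pot nu x := fun x =>
    integral_mono_measure hle (Eventually.of_forall fun _ => le_max_right _ _) (integrable_pot hn x)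
  have hfc : Continuous (fun x => pot nu x - pot mu x) :=
    (convexOn_cont hpn).sub (convexOn_cont hpm)
  obtain ⟨c, hc⟩ := exists_hull (f := fun x => pot nu x - pot mu x) hc0
    (fun x => by have := hp x; linarith)
  have hc1 : ∀ x, pot nu x - pot S x ≤ c x :=
    hc.2.2 _ hc0 (fun x => by have := hp x; linarith)
  have hcf : ∀ x, c x ≤ pot nu x - pot mu x := hc.2.1
  have hQ : ConvexOn ℝ Set.univ (fun x => pot nu x - c x) := by
    refine convexOn_of_local_mid (Q := fun x => pot nu x - c x) ((convexOn_cont hpn).sub (convexOn_cont hc.1)) fun y => ?_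
    rcases lt_or_eq_of_le (hcf y) with hy | hy
    · obtain ⟨δ, hδ, hd⟩ := hull_local_affine hfc hc hy
      refine ⟨δ, hδ, fun d h1 h2 => ?_⟩
      have := hd d h1 h2
      have := convexOn_mid hpn y d
      linarith
    · refine ⟨1, one_pos, fun d _ _ => ?_⟩
      have := convexOn_mid hpm y d
      have := hcf (y + d)
      have := hcf (y - d)
      linarith
  have hcn : ∀ x, 0 ≤ c x := fun x => by
    have := hc1 x
    have := hpSn x
    linarith
  have hbound : ∀ x, 0 ≤ x → pot nu x ≤ nu.real univ * x + (cpot nu 0 - ∫ x, x ∂nu) := by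
    intro x hx
    rw [pot_sub_cpot hn]
    have : cpot nu x ≤ cpot nu 0 := integral_mono (integrable_cpot hn x) (integrable_cpot hn 0)
      fun y => max_le_max (by linarith) le_rfl
    linarith
  obtain ⟨S', hS'f, hS'i, hS'p⟩ := exists_measure_pot hQ
    (fun x => by have := hcf x; have := pot_nonneg mu x; linarith)
    (fun x => by have := hcn x; linarith) (pot_tendsto_atBot hn) hbound
  obtain ⟨C', hC'f, hC'i, hC'p⟩ := exists_measure_pot hc.1 hcn
    (fun x => by have := hcf x; have := pot_nonneg mu x; linarith) (pot_tendsto_atBot hn) hbound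
  have hsum : S' + C' = nu := by
    apply eq_of_pot_eq (fun k => (hS'i k).add_measure (hC'i k)) (integrable_pot hn)
    intro k
    rw [pot_add hS'i hC'i, hS'p, hC'p]
    ring
  have hS'le : S' ≤ nu := by
    rw [← hsum]
    exact Measure.le_add_right le_rfl
  have hS'id : Integrable (fun x => x) S' := hn.mono_measure hS'le
  have hpm' : ∀ k, pot mu k ≤ pot S' k := fun k => by
    rw [hS'p]; have := hcf k; linarith
  have hlim : Tendsto (fun k => pot S' k - pot mu k) atTop (nhds 0) := by
    refine tendsto_of_tendsto_of_tendsto_of_le_of_le tendsto_const_nhds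
      (W_tendsto hm hSi hmass hmean).1 (fun k => ?_) (fun k => ?_)
    · have := hpm' k
      simp only
      linarith
    · have := hc1 k
      simp only
      rw [hS'p]
      linarith
  have hlim2 : Tendsto (fun k => (S'.real univ - mu.real univ) * k -
      (∫ x, x ∂S' - ∫ x, x ∂mu)) atTop (nhds 0) := by
    have := hlim.sub ((cpot_tendsto_atTop hS'id).sub (cpot_tendsto_atTop hm))
    simp only [sub_zero] at this
    refine this.congr fun k => ?_
    rw [pot_sub_cpot hS'id, pot_sub_cpot hm]
    ring
  obtain ⟨hA, hB⟩ := aff_tendsto hlim2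
  have hcxS' : Cx mu S' := fun f hf _ hfS' =>
    (cx_strong hm hS'id (by linarith) (by linarith) hpm' hf hfS').2
  have hfinal := (cx_facts hSi hS'id (hmin S' hcxS' hS'le)).1
  have hceq : ∀ y, pot nu y - pot S y = c y := by
    intro y
    have h1 := hfinal y
    have h2 := hc1 y
    rw [hS'p] at h1
    linarith
  simp_rw [hceq]
  apply hull_local_affine hfc hc
  rw [← hceq]
  linarith

lemma W_mono {xi mu nu S S1 : Measure ℝ} [IsFiniteMeasure xi] [IsFiniteMeasure mu]
    [IsFiniteMeasure nu] [IsFiniteMeasure S]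
    (hm : Integrable (fun x => x) mu) (hn : Integrable (fun x => x) nu)
    (hle : xi ≤ mu) (hSm : Cx mu S) (hSn : S ≤ nu) (hS1 : IsShadow xi nu S1) (x : ℝ) :
    pot S1 x - pot xi x ≤ pot S x - pot mu x := by
  have : IsFiniteMeasure S1 := isFiniteMeasure_of_le nu hS1.2.1
  have hx : Integrable (fun x => x) xi := hm.mono_measure hle
  have hs : Integrable (fun x => x) S := hn.mono_measure hSn
  have hs1 : Integrable (fun x => x) S1 := hn.mono_measure hS1.2.1
  obtain ⟨p1, m1, b1⟩ := cx_facts hx hs1 hS1.1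
  obtain ⟨p, m, b⟩ := cx_facts hm hs hSm
  have t1 := W_tendsto hx hs1 m1 b1
  have t := W_tendsto hm hs m b
  have cc : ∀ {η : Measure ℝ} [IsFiniteMeasure η], Integrable (fun x => x) η →
      Continuous (pot η) := fun h => convexOn_cont (convexOn_pot (integrable_pot h))
  have := max_principle_top (V := fun x => (pot S1 x - pot xi x) - (pot S x - pot mu x))
    (((cc hs1).sub (cc hx)).sub ((cc hs).sub (cc hm)))
    (by simpa using t1.1.sub t.1) (by simpa using t1.2.sub t.2) (by
      intro y hy
      obtain ⟨δ, hδ, hd⟩ := keyA hx hn hS1 (x := y) (by have := p y; linarith)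
      refine ⟨δ, hδ, fun d d0 d1 => ?_⟩
      have h1 := hd d d0 d1
      have h2 := convexOn_mid (convexOn_pot_sub hn hSn) y d
      have h3 := convexOn_mid (convexOn_pot_sub hm hle) y d
      linarith) x
  linarith

theorem stmt18 (xi mu nu : Measure ℝ)
    [IsFiniteMeasure xi] [IsFiniteMeasure mu] [IsFiniteMeasure nu]
    (hintx : Integrable (fun x => x) xi) (hintm : Integrable (fun x => x) mu)
    (hintn : Integrable (fun x => x) nu)
    (hle : xi ≤ mu) (hE : ECx mu nu)
    (S : Measure ℝ) (hS : IsShadow mu nu S) :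
    ECx xi nu ∧ ECx xi S ∧
      ∀ S1 S2 : Measure ℝ, IsShadow xi nu S1 → IsShadow xi S S2 → S2 = S1 := by
  have : IsFiniteMeasure S := isFiniteMeasure_of_le nu hS.2.1
  have hs : Integrable (fun x => x) S := hintn.mono_measure hS.2.1
  obtain ⟨p, m, b⟩ := cx_facts hintm hs hS.1
  refine ⟨fun f hf h0 => (lintegral_mono' hle le_rfl).trans (hE f hf h0), fun f hf h0 => ?_, ?_⟩
  · refine (lintegral_mono' hle le_rfl).trans ?_
    by_cases hfin : ∫⁻ x, ENNReal.ofReal (f x) ∂S = ⊤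
    · rw [hfin]; exact le_top
    · have hfS : Integrable f S := by
        refine ⟨(convexOn_cont hf).aestronglyMeasurable, ?_⟩
        rw [hasFiniteIntegral_iff_ofReal (Eventually.of_forall h0)]
        exact lt_top_iff_ne_top.mpr hfin
      obtain ⟨h1, h2⟩ := cx_strong hintm hs m b p hf hfS
      rw [← ofReal_integral_eq_lintegral_ofReal h1 (Eventually.of_forall h0),
        ← ofReal_integral_eq_lintegral_ofReal hfS (Eventually.of_forall h0)]
      exact ENNReal.ofReal_le_ofReal h2
  · intro S1 S2 hS1 hS2
    have : IsFiniteMeasure S1 := isFiniteMeasure_of_le nu hS1.2.1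
    have : IsFiniteMeasure S2 := isFiniteMeasure_of_le S hS2.2.1
    have hs1 : Integrable (fun x => x) S1 := hintn.mono_measure hS1.2.1
    have hs2 : Integrable (fun x => x) S2 := hs.mono_measure hS2.2.1
    -- `S1` precedes `S2`
    obtain ⟨p12, m12, b12⟩ := cx_facts hs1 hs2
      (hS1.2.2 S2 hS2.1 (hS2.2.1.trans hS.2.1))
    obtain ⟨p1, m1, b1⟩ := cx_facts hintx hs1 hS1.1
    have t := W_tendsto hs1 hs2 m12 b12
    have cc : ∀ {η : Measure ℝ} [IsFiniteMeasure η], Integrable (fun x => x) η →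
        Continuous (pot η) := fun h => convexOn_cont (convexOn_pot (integrable_pot h))
    have hV := max_principle_top (V := fun x => pot S2 x - pot S1 x) ((cc hs2).sub (cc hs1))
      t.1 t.2 (by
        intro y hy
        have hy2 : pot xi y < pot S2 y := by have := p1 y; linarith
        have hy1 : pot mu y < pot S y := by
          have := W_mono hintm hs hle hS.1 le_rfl hS2 y
          linarith
        obtain ⟨δ1, hδ1, hd1⟩ := keyA hintm hintn hS hy1
        obtain ⟨δ2, hδ2, hd2⟩ := keyA hintx hs hS2 hy2
        refine ⟨min δ1 δ2, lt_min hδ1 hδ2, fun d d0 d1 => ?_⟩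
        have h1 := hd1 d d0 (lt_of_lt_of_le d1 (min_le_left _ _))
        have h2 := hd2 d d0 (lt_of_lt_of_le d1 (min_le_right _ _))
        have h3 := convexOn_mid (convexOn_pot_sub hintn hS1.2.1) y d
        linarith)
    apply eq_of_pot_eq (integrable_pot hs2) (integrable_pot hs1)
    intro k
    have := hV k
    have := p12 k
    linarith
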